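/- Let W_k : ℝⁿ × ℝⁿ × ℝⁿ → ℝ (k = 1, …, m) be convex and let f(·, t) : ℝⁿ → ℝ be convex and differentiable with t ↦ f(x(t), t) and t ↦ f(x̃(t), t) integrable on [0,1]. Let x̃, x : [0,1] → ℝⁿ be twice differentiable arcs with integrable second derivatives satisfying x(0) = x̃(0), x'(0) = x̃'(0), and W_k(x(t), x'(t), x''(t)) ≤ 0 for a.e. t ∈ [0,1] and every k. Suppose x*, ψ* : [0,1] → ℝⁿ (x* twice differentiable with integrable second derivative, ψ* differentiable with integrable derivative) and measurable α_k : [0,1] → [0,∞) satisfy, for a.e. t ∈ [0,1]: there exist subgradients s_k(t) ∈ ∂W_k(x̃(t), x̃'(t), x̃''(t)) with (x*''(t) + ψ*'(t) − ∇f(x̃(t), t), ψ*(t), −x*(t)) = ∑_{k=1}^m α_k(t) s_k(t), and α_k(t) · W_k(x̃(t), x̃'(t), x̃''(t)) = 0 for every k; and x*(1) = 0. Then ∫₀¹ (f(x(t), t) − f(x̃(t), t)) dt ≥ ⟨x*'(1), x(1) − x̃(1)⟩ + ⟨ψ*(1), x(1) − x̃(1)⟩. -/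

import Mathlib

open scoped RealInnerProductSpace
open Set MeasureTheory

noncomputable section

abbrev E (n : ℕ) := EuclideanSpace ℝ (Fin n)

/-- The product inner product on `ℝⁿ × ℝⁿ × ℝⁿ`. -/
def inner3 {n : ℕ} (a b : E n × E n × E n) : ℝ :=
  ⟪a.1, b.1⟫ + ⟪a.2.1, b.2.1⟫ + ⟪a.2.2, b.2.2⟫

/-- `s` is a subgradient of `g : ℝⁿ × ℝⁿ × ℝⁿ → ℝ` at `x`. -/
def IsSubgrad3 {n : ℕ} (g : E n × E n × E n → ℝ) (x s : E n × E n × E n) : Prop :=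
  ∀ y, g y - g x ≥ inner3 s (y - x)

/-- The product inner product on `ℝⁿ × ℝⁿ`. -/
def inner2 {n : ℕ} (a b : E n × E n) : ℝ :=
  ⟪a.1, b.1⟫ + ⟪a.2, b.2⟫

/-- `s` is a subgradient of `g : ℝⁿ × ℝⁿ → ℝ` at `x`. -/
def IsSubgrad2 {n : ℕ} (g : E n × E n → ℝ) (x s : E n × E n) : Prop :=
  ∀ y, g y - g x ≥ inner2 s (y - x)

/-- `s` is a subgradient of `g : ℝⁿ → ℝ` at `x`. -/
def IsSubgrad1 {n : ℕ} (g : E n → ℝ) (x s : E n) : Prop :=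
  ∀ y, g y - g x ≥ ⟪s, y - x⟫

theorem inner3_sum_smul {n : ℕ} {ι : Type*} (I : Finset ι) (a : ι → ℝ)
    (s : ι → E n × E n × E n) (v : E n × E n × E n) :
    inner3 (∑ k ∈ I, a k • s k) v = ∑ k ∈ I, a k * inner3 (s k) v := by
  simp [inner3, Prod.fst_sum, Prod.snd_sum, sum_inner, real_inner_smul_left, mul_add,
    Finset.sum_add_distrib]

theorem inner3_multipliers_nonpos {n : ℕ} {ι : Type*} (I : Finset ι)
    {g : ι → E n × E n × E n → ℝ} {a : ι → ℝ} {s : ι → E n × E n × E n}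
    {u v : E n × E n × E n} (ha : ∀ k ∈ I, 0 ≤ a k)
    (hs : ∀ k ∈ I, IsSubgrad3 (g k) u (s k)) (hcompl : ∀ k ∈ I, a k * g k u = 0)
    (hv : ∀ k ∈ I, g k v ≤ 0) :
    inner3 (∑ k ∈ I, a k • s k) (v - u) ≤ 0 := by
  rw [inner3_sum_smul]
  refine Finset.sum_nonpos fun k hk => ?_
  have hsub := mul_le_mul_of_nonneg_left (hs k hk v) (ha k hk)
  have hfeas := mul_nonpos_of_nonneg_of_nonpos (ha k hk) (hv k hk)
  rw [mul_sub] at hsub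
  linarith [hcompl k hk]

theorem ConvexOn.inner_gradient_le_sub {F : Type*} [NormedAddCommGroup F]
    [InnerProductSpace ℝ F] [CompleteSpace F] {g : F → ℝ} (hg : ConvexOn ℝ univ g) {x : F}
    (hd : DifferentiableAt ℝ g x) (y : F) :
    ⟪gradient g x, y - x⟫ ≤ g y - g x := by
  have hline : ConvexOn ℝ univ (g ∘ AffineMap.lineMap (k := ℝ) x y) := by
    simpa using hg.comp_affineMap (AffineMap.lineMap (k := ℝ) x y)
  have hderiv : HasDerivAt (g ∘ AffineMap.lineMap (k := ℝ) x y) (fderiv ℝ g x (y - x)) 0 := by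
    refine HasFDerivAt.comp_hasDerivAt (0 : ℝ) ?_ AffineMap.hasDerivAt_lineMap
    simpa using hd.hasFDerivAt
  have hslope := hline.le_slope_of_hasDerivAt (mem_univ 0) (mem_univ 1) one_pos hderiv
  rw [inner_gradient_left]
  simpa [slope_def_field] using hslope

theorem MeasureTheory.IntegrableOn.inner_continuousOn {X F : Type*} [TopologicalSpace X]
    [T2Space X] [MeasurableSpace X] [OpensMeasurableSpace X] [NormedAddCommGroup F]
    [InnerProductSpace ℝ F] {μ : Measure X} {K : Set X} {u v : X → F}
    [SecondCountableTopologyEither X F]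
    (hu : IntegrableOn u K μ) (hv : ContinuousOn v K) (hK : IsCompact K) :
    IntegrableOn (fun t => ⟪u t, v t⟫) K μ := by
  have hbound : IntegrableOn (fun t => ‖u t‖ * ‖v t‖) K μ :=
    IntegrableOn.mul_continuousOn hu.norm hv.norm hK
  exact hbound.mono' (hu.1.inner (hv.aestronglyMeasurable hK.measurableSet))
    (Filter.Eventually.of_forall fun t => norm_inner_le_norm (u t) (v t))

theorem stmt18 (n m : ℕ)
    (W : Fin m → E n × E n × E n → ℝ) (hWconv : ∀ k, ConvexOn ℝ univ (W k))
    (f : ℝ → E n → ℝ)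
    (hfconv : ∀ t, ConvexOn ℝ univ (f t))
    (hfdiff : ∀ t, Differentiable ℝ (f t))
    (x x' x'' xtil xtil' xtil'' : ℝ → E n)
    (hfintx : IntervalIntegrable (fun t => f t (x t)) volume 0 1)
    (hfintxtil : IntervalIntegrable (fun t => f t (xtil t)) volume 0 1)
    (hx : ∀ t ∈ Icc (0 : ℝ) 1, HasDerivWithinAt x (x' t) (Icc 0 1) t)
    (hx' : ∀ t ∈ Icc (0 : ℝ) 1, HasDerivWithinAt x' (x'' t) (Icc 0 1) t)
    (hxint : IntegrableOn x'' (Icc (0 : ℝ) 1))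
    (hxtil : ∀ t ∈ Icc (0 : ℝ) 1, HasDerivWithinAt xtil (xtil' t) (Icc 0 1) t)
    (hxtil' : ∀ t ∈ Icc (0 : ℝ) 1, HasDerivWithinAt xtil' (xtil'' t) (Icc 0 1) t)
    (hxtilint : IntegrableOn xtil'' (Icc (0 : ℝ) 1))
    (hinit0 : x 0 = xtil 0) (hinit1 : x' 0 = xtil' 0)
    (hxfeas : ∀ᵐ t : ℝ ∂volume, t ∈ Icc (0 : ℝ) 1 → ∀ k, W k (x t, x' t, x'' t) ≤ 0)
    (xs xs' xs'' ψs ψs' : ℝ → E n)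
    (hxs : ∀ t ∈ Icc (0 : ℝ) 1, HasDerivWithinAt xs (xs' t) (Icc 0 1) t)
    (hxs' : ∀ t ∈ Icc (0 : ℝ) 1, HasDerivWithinAt xs' (xs'' t) (Icc 0 1) t)
    (hψs : ∀ t ∈ Icc (0 : ℝ) 1, HasDerivWithinAt ψs (ψs' t) (Icc 0 1) t)
    (hxsint : IntegrableOn xs'' (Icc (0 : ℝ) 1))
    (hψsint : IntegrableOn ψs' (Icc (0 : ℝ) 1))
    (α : Fin m → ℝ → ℝ)
    (hαmeas : ∀ k, Measurable (α k))
    (hαpos : ∀ k, ∀ t ∈ Icc (0 : ℝ) 1, 0 ≤ α k t)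
    (hadj : ∀ᵐ t : ℝ ∂volume, t ∈ Icc (0 : ℝ) 1 →
      (∃ sk : Fin m → E n × E n × E n,
        (∀ k, IsSubgrad3 (W k) (xtil t, xtil' t, xtil'' t) (sk k)) ∧
        (xs'' t + ψs' t - gradient (f t) (xtil t), ψs t, -xs t) =
          ∑ k, α k t • sk k) ∧
      (∀ k, α k t * W k (xtil t, xtil' t, xtil'' t) = 0))
    (hend : xs 1 = 0) :
    (∫ t in (0 : ℝ)..1, (f t (x t) - f t (xtil t))) ≥
      ⟪xs' 1, x 1 - xtil 1⟫ + ⟪ψs 1, x 1 - xtil 1⟫ := by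
  have hd := fun t ht => (hx t ht).sub (hxtil t ht)
  have hd' := fun t ht => (hx' t ht).sub (hxtil' t ht)
  have hF := fun t ht => (((hxs' t ht).inner ℝ (hd t ht)).sub
    ((hxs t ht).inner ℝ (hd' t ht))).add ((hψs t ht).inner ℝ (hd t ht))
  have hdcont := HasDerivWithinAt.continuousOn hd
  have hd'cont := HasDerivWithinAt.continuousOn hd'
  have hxscont := HasDerivWithinAt.continuousOn hxs
  have hxs'cont := HasDerivWithinAt.continuousOn hxs'
  have hψscont := HasDerivWithinAt.continuousOn hψs
  have hxsd'' : IntegrableOn (fun t => ⟪xs t, x'' t - xtil'' t⟫) (Icc (0 : ℝ) 1) := by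
    simpa only [real_inner_comm, Pi.sub_apply] using
      (hxint.sub hxtilint).inner_continuousOn hxscont isCompact_Icc
  have hF'int := ((((hxs'cont.inner hd'cont).integrableOn_Icc (μ := volume)).add
    (hxsint.inner_continuousOn hdcont isCompact_Icc)).sub
    (hxsd''.add ((hxs'cont.inner hd'cont).integrableOn_Icc))).add
    (((hψscont.inner hd'cont).integrableOn_Icc).add
    (hψsint.inner_continuousOn hdcont isCompact_Icc))
  have hF'int' := (intervalIntegrable_iff_integrableOn_Icc_of_le zero_le_one).2 hF'int
  have hftc := intervalIntegral.integral_eq_sub_of_hasDerivAt_of_le zero_le_one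
    (HasDerivWithinAt.continuousOn hF)
    (fun t ht => (hF t (Ioo_subset_Icc_self ht)).hasDerivAt (Icc_mem_nhds ht.1 ht.2)) hF'int'
  have hmono := intervalIntegral.integral_mono_ae_restrict zero_le_one hF'int'
    (hfintx.sub hfintxtil) (by
      rw [Filter.EventuallyLE, ae_restrict_iff' measurableSet_Icc]
      filter_upwards [hxfeas, hadj] with t hfeas hadj ht
      obtain ⟨⟨s, hs, hsum⟩, hcompl⟩ := hadj ht
      have hnonpos := inner3_multipliers_nonpos Finset.univ (fun k _ => hαpos k t ht)
        (fun k _ => hs k) (fun k _ => hcompl k) (fun k _ => hfeas ht k)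
      have hgrad := (hfconv t).inner_gradient_le_sub (hfdiff t (xtil t)) (x t)
      rw [← hsum] at hnonpos
      simp only [inner3, Prod.fst_sub, Prod.snd_sub, inner_sub_left, inner_add_left,
        inner_neg_left] at hnonpos
      simp only [Pi.add_apply, Pi.sub_apply]
      linarith)
  simpa [hend, hinit0, hinit1] using hftc.symm.trans_le hmono
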